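/- arXiv:cs/9910010 — 8 statements merged into one kernel-verified Lean document; each statement's English description precedes it below -/
import Mathlib

section
/- Let p be a multilinear real polynomial in the 2n variables x_1,…,x_n, y_1,…,y_n which is even, meaning that every monomial with nonzero coefficient contains the variable x_i if and only if it contains the variable y_i (for each i), and suppose p has exactly k monomials with nonzero coefficient. Then the 2^n × 2^n real matrix P, indexed by x, y ∈ {0,1}^n and with entries P(x,y) = p(x,y), has rank exactly k over ℝ. -/
def zetaM (n : ℕ) : Matrix (Finset (Fin n)) (Finset (Fin n)) ℝ :=
  Matrix.of fun T S => if S ⊆ T then (1 : ℝ) else 0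

lemma zetaM_isUnit (n : ℕ) : IsUnit (zetaM n) := by
  rw [← Matrix.mulVec_injective_iff_isUnit]
  intro v w h
  funext T
  induction T using Finset.strongInduction with
  | H T ih =>
    have h1 := congrFun h T
    simp only [Matrix.mulVec, dotProduct, zetaM, Matrix.of_apply] at h1
    rw [← Finset.add_sum_erase _ _ (Finset.mem_univ T),
      ← Finset.add_sum_erase _ (fun x => _ * w x) (Finset.mem_univ T)] at h1
    have h2 : ∑ x ∈ Finset.univ.erase T, (if x ⊆ T then (1 : ℝ) else 0) * v x
        = ∑ x ∈ Finset.univ.erase T, (if x ⊆ T then (1 : ℝ) else 0) * w x := by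
      refine Finset.sum_congr rfl fun x hx => ?_
      by_cases hs : x ⊆ T
      · rw [ih x (lt_of_le_of_ne hs (Finset.ne_of_mem_erase hx))]
      · simp [hs]
    rw [h2] at h1
    simpa only [subset_refl, if_true, one_mul, add_left_inj] using h1

def finsetBool (n : ℕ) : Finset (Fin n) ≃ (Fin n → Bool) where
  toFun S i := decide (i ∈ S)
  invFun x := Finset.univ.filter fun i => x i = true
  left_inv S := by ext; simp
  right_inv x := by funext i; simp

lemma prod_finsetBool (n : ℕ) (S T : Finset (Fin n)) :
    (∏ i ∈ S, if finsetBool n T i then (1 : ℝ) else 0) = zetaM n T S := by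
  simp [finsetBool, zetaM, Finset.prod_ite_zero, Finset.subset_iff]


/-- If `p` is an even multilinear polynomial in variables `x_1,…,x_n,y_1,…,y_n`
(every nonzero monomial contains `x_i` iff it contains `y_i`) with exactly `k`
nonzero monomials, then the `2^n × 2^n` matrix of its values on Boolean inputs
has rank exactly `k`.  A multilinear polynomial in the `2n` variables is given
by its coefficients `c : Finset (Fin n) × Finset (Fin n) → ℝ`, the monomial
indexed by `(S, T)` being `∏_{i ∈ S} x_i ∏_{i ∈ T} y_i`. -/
theorem stmt_2 (n k : ℕ) (c : Finset (Fin n) × Finset (Fin n) → ℝ)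
    (heven : ∀ p, c p ≠ 0 → p.1 = p.2)
    (hk : {p : Finset (Fin n) × Finset (Fin n) | c p ≠ 0}.ncard = k) :
    (Matrix.of (fun (x y : Fin n → Bool) =>
        ∑ p : Finset (Fin n) × Finset (Fin n),
          c p * (∏ i ∈ p.1, if x i then (1 : ℝ) else 0) *
            (∏ i ∈ p.2, if y i then (1 : ℝ) else 0))).rank = k := by

  set M := Matrix.of (fun (x y : Fin n → Bool) =>
        ∑ p : Finset (Fin n) × Finset (Fin n),
          c p * (∏ i ∈ p.1, if x i then (1 : ℝ) else 0) *
            (∏ i ∈ p.2, if y i then (1 : ℝ) else 0)) with hM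
  have key : M.submatrix (finsetBool n) (finsetBool n)
      = zetaM n * Matrix.diagonal (fun S => c (S, S)) * (zetaM n).transpose := by
    ext x y
    simp only [hM, Matrix.submatrix_apply, Matrix.of_apply, prod_finsetBool]
    rw [Matrix.mul_apply, Fintype.sum_prod_type]
    refine Finset.sum_congr rfl fun S _ => ?_
    rw [Matrix.mul_diagonal, Matrix.transpose_apply, Finset.sum_eq_single S]
    · ring
    · intro T _ hT
      have : c (S, T) = 0 := by
        by_contra h
        exact hT (heven _ h).symm
      simp [this]
    · simp
  have hu := (Matrix.isUnit_iff_isUnit_det _).1 (zetaM_isUnit n)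
  rw [← Matrix.rank_submatrix M (finsetBool n) (finsetBool n), key,
    Matrix.rank_mul_eq_left_of_isUnit_det _ _ (by rwa [Matrix.det_transpose]),
    Matrix.rank_mul_eq_right_of_isUnit_det _ _ hu, Matrix.rank_diagonal, ← hk,
    ← Nat.card_coe_set_eq, ← Nat.card_eq_fintype_card]
  refine Nat.card_congr ⟨fun S => ⟨(S.1, S.1), S.2⟩, fun p => ⟨p.1.1, ?_⟩, ?_, ?_⟩
  · obtain ⟨⟨S, T⟩, hp⟩ := p
    have h : S = T := heven _ hp
    subst h
    exact hp
  · intro S; rfl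
  · rintro ⟨⟨S, T⟩, hp⟩
    have h : S = T := heven _ hp
    subst h
    rfl
end

section
/- Let g : {0,1}^n → {0,1} and define f : {0,1}^n × {0,1}^n → {0,1} by f(x,y) = g(x ∧ y), where x ∧ y denotes the bitwise AND of x and y. Then the rank over ℝ of the 2^n × 2^n matrix M_f with entries M_f(x,y) = f(x,y) equals mon(g), the number of monomials with nonzero coefficient in the unique multilinear real polynomial that represents g on {0,1}^n. -/
lemma zeta_isUnit (n : ℕ) :
    IsUnit (Matrix.of (fun (T S : Finset (Fin n)) => if S ⊆ T then (1 : ℝ) else 0)) := by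
  rw [← Matrix.mulVec_injective_iff_isUnit]
  refine (injective_iff_map_eq_zero (Matrix.mulVecLin _)).2 ?_
  intro v hv
  funext T
  induction T using Finset.strongInduction with
  | H T ih =>
    have h := congrFun hv T
    simp only [Matrix.mulVecLin_apply, Matrix.mulVec, dotProduct, Matrix.of_apply] at h
    rw [Finset.sum_eq_single T] at h
    · simpa using h
    · intro S _ hS
      by_cases hs : S ⊆ T
      · rw [ih S (Finset.ssubset_iff_subset_ne.2 ⟨hs, hS⟩)]; simp
      · simp [hs]
    · simp

/-- If `g : {0,1}^n → {0,1}` is represented by the multilinear polynomial with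
coefficients `a`, and `f(x,y) = g(x ∧ y)`, then the rank of the matrix `M_f`
equals `mon(g)`, the number of nonzero monomials of `g`. -/
theorem stmt_3 (n : ℕ) (g : (Fin n → Bool) → Bool) (a : Finset (Fin n) → ℝ)
    (hrep : ∀ x : Fin n → Bool,
      (if g x then (1 : ℝ) else 0) =
        ∑ S : Finset (Fin n), a S * ∏ i ∈ S, if x i then (1 : ℝ) else 0) :
    (Matrix.of (fun (x y : Fin n → Bool) =>
        if g (fun i => x i && y i) then (1 : ℝ) else 0)).rank =
      {S : Finset (Fin n) | a S ≠ 0}.ncard := by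
  classical
  let e : (Fin n → Bool) ≃ Finset (Fin n) :=
    { toFun := fun x => Finset.univ.filter (fun i => x i = true)
      invFun := fun S i => decide (i ∈ S)
      left_inv := fun x => by funext i; simp
      right_inv := fun S => by ext i; simp }
  let W : Matrix (Finset (Fin n)) (Finset (Fin n)) ℝ :=
    Matrix.of (fun T S => if S ⊆ T then (1 : ℝ) else 0)
  have hW : IsUnit W := zeta_isUnit n
  have hdet : IsUnit W.det := (Matrix.isUnit_iff_isUnit_det _).1 hW
  have hdet' : IsUnit W.transpose.det := by rwa [Matrix.det_transpose]
  have key : Matrix.of (fun (x y : Fin n → Bool) =>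
        if g (fun i => x i && y i) then (1 : ℝ) else 0) =
      (W * Matrix.diagonal a * W.transpose).submatrix e e := by
    ext x y
    rw [Matrix.of_apply, hrep, Matrix.submatrix_apply, Matrix.mul_apply]
    refine Finset.sum_congr rfl fun S _ => ?_
    rw [Matrix.mul_diagonal, Finset.prod_ite_zero]
    simp only [W, e, Matrix.transpose_apply, Matrix.of_apply, Equiv.coe_fn_mk,
      Finset.subset_iff, Finset.mem_filter, Finset.mem_univ, true_and, Bool.and_eq_true,
      Finset.prod_const_one]
    by_cases h1 : ∀ i ∈ S, x i = true <;> by_cases h2 : ∀ i ∈ S, y i = true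
    · have h3 : ∀ i ∈ S, x i = true ∧ y i = true := fun i hi => ⟨h1 i hi, h2 i hi⟩
      rw [if_pos h3, if_pos h1, if_pos h2]; ring
    · have h3 : ¬ ∀ i ∈ S, x i = true ∧ y i = true := fun h => h2 fun i hi => (h i hi).2
      rw [if_neg h3, if_neg h2]; ring
    · have h3 : ¬ ∀ i ∈ S, x i = true ∧ y i = true := fun h => h1 fun i hi => (h i hi).1
      rw [if_neg h3, if_neg h1]; ring
    · have h3 : ¬ ∀ i ∈ S, x i = true ∧ y i = true := fun h => h1 fun i hi => (h i hi).1
      rw [if_neg h3, if_neg h1]; ring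
  rw [key, Matrix.rank_submatrix, Matrix.rank_mul_eq_left_of_isUnit_det _ _ hdet',
    Matrix.rank_mul_eq_right_of_isUnit_det _ _ hdet, Matrix.rank_diagonal,
    ← Nat.card_coe_set_eq, Nat.card_eq_fintype_card]
  rfl
end

section
/- Let g : {0,1}^n → {0,1} be a symmetric Boolean function (g(x) depends only on the Hamming weight |x|), and suppose the minimum Hamming weight of an input x with g(x) = 1 is t, where 1 ≤ t ≤ n. Define f(x,y) = g(x ∧ y). Then the number of distinct rows of the 2^n × 2^n matrix M_f, i.e., the cardinality of the set { (f(x,y))_{y ∈ {0,1}^n} : x ∈ {0,1}^n }, equals (∑_{i=t}^n C(n,i)) + 1, where C(n,i) is the binomial coefficient. -/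
/-- If `g` is a symmetric Boolean function whose lowest-weight 1-input has
Hamming weight `t` (with `1 ≤ t ≤ n`), and `f(x,y) = g(x ∧ y)`, then the number
of distinct rows of `M_f` equals `(∑_{i=t}^n C(n,i)) + 1`. -/
theorem stmt_5 (n t : ℕ) (g : (Fin n → Bool) → Bool)
    (hsym : ∀ x y : Fin n → Bool,
      (Finset.univ.filter fun i => x i = true).card =
        (Finset.univ.filter fun i => y i = true).card → g x = g y)
    (ht1 : 1 ≤ t) (htn : t ≤ n)
    (hmin : ∀ x : Fin n → Bool, g x = true →
      t ≤ (Finset.univ.filter fun i => x i = true).card)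
    (hex : ∃ x : Fin n → Bool,
      (Finset.univ.filter fun i => x i = true).card = t ∧ g x = true) :
    {r : (Fin n → Bool) → Bool |
        ∃ x : Fin n → Bool, r = fun y => g (fun i => x i && y i)}.ncard =
      (∑ i ∈ Finset.Icc t n, n.choose i) + 1 := by
  classical
  let row : Finset (Fin n) → ((Fin n → Bool) → Bool) :=
    fun S y => g (fun i => decide (i ∈ S) && y i)
  have hrow : ∀ S T : Finset (Fin n),
      row S (fun i => decide (i ∈ T)) = g (fun i => decide (i ∈ S ∩ T)) := by
    intro S T
    simp only [row, Finset.mem_inter, Bool.decide_and]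
  have hlow : ∀ x : Fin n → Bool,
      (Finset.univ.filter fun i => x i = true).card < t → g x = false := by
    intro x hx
    by_contra h
    have := hmin x (by simpa using h)
    omega
  have hT : ∀ T : Finset (Fin n), T.card = t → g (fun i => decide (i ∈ T)) = true := by
    intro T hT
    obtain ⟨x, hx, hg⟩ := hex
    rw [← hg]
    apply hsym
    rw [hx, ← hT]
    congr 1
    ext i
    simp
  have hL : ∀ T : Finset (Fin n), T.card < t → g (fun i => decide (i ∈ T)) = false := by
    intro T hT
    apply hlow
    have : (Finset.univ.filter fun i => decide (i ∈ T) = true) = T := by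
      ext i
      simp
    rw [this]
    exact hT
  have hsub : ∀ S S' : Finset (Fin n), t ≤ S.card → row S = row S' → S ⊆ S' := by
    intro S S' hS h i hi
    by_contra hi'
    obtain ⟨T, h1, h2, h3⟩ := Finset.exists_subsuperset_card_eq
      (Finset.singleton_subset_iff.mpr hi) (by simpa using ht1) hS
    have e := congrFun h (fun i => decide (i ∈ T))
    rw [hrow, hrow, Finset.inter_eq_right.mpr h2, hT T h3, hL] at e
    · exact absurd e (by simp)
    · rw [← h3]
      apply Finset.card_lt_card
      refine ⟨Finset.inter_subset_right, fun hh => hi' ?_⟩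
      exact (Finset.mem_inter.mp (hh (h1 (Finset.mem_singleton_self i)))).1
  let F : Finset (Finset (Fin n)) := Finset.univ.filter fun S => t ≤ S.card
  have hset : {r : (Fin n → Bool) → Bool |
        ∃ x : Fin n → Bool, r = fun y => g (fun i => x i && y i)} =
      insert (fun _ => false) (row '' (F : Set (Finset (Fin n)))) := by
    ext r
    simp only [Set.mem_setOf_eq, Set.mem_insert_iff, Set.mem_image]
    constructor
    · rintro ⟨x, rfl⟩
      by_cases hx : t ≤ (Finset.univ.filter fun i => x i = true).card
      · right
        refine ⟨Finset.univ.filter fun i => x i = true, by simpa [F] using hx, ?_⟩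
        funext y
        simp [row]
      · left
        funext y
        apply hlow
        refine lt_of_le_of_lt (Finset.card_le_card ?_) (not_le.mp hx)
        intro i
        simp only [Finset.mem_filter, Bool.and_eq_true]
        tauto
    · rintro (rfl | ⟨S, -, rfl⟩)
      · refine ⟨fun _ => false, ?_⟩
        funext y
        symm
        apply hlow
        simp
        omega
      · exact ⟨fun i => decide (i ∈ S), rfl⟩
  have hinj : Set.InjOn row (F : Set (Finset (Fin n))) := by
    intro S hS S' hS' h
    have h1 : t ≤ S.card := by simpa [F] using hS
    have h2 : t ≤ S'.card := by simpa [F] using hS'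
    exact (hsub S S' h1 h).antisymm (hsub S' S h2 h.symm)
  have hnot : (fun _ => false) ∉ row '' (F : Set (Finset (Fin n))) := by
    rintro ⟨S, hS, h⟩
    have h1 : t ≤ S.card := by simpa [F] using hS
    obtain ⟨T, h2, h3⟩ := Finset.exists_subset_card_eq h1
    have e := congrFun h (fun i => decide (i ∈ T))
    rw [hrow, Finset.inter_eq_right.mpr h2, hT T h3] at e
    exact absurd e (by simp)
  rw [hset, Set.ncard_insert_of_notMem hnot (Set.toFinite _), Set.ncard_image_of_injOn hinj,
    Set.ncard_coe_finset]
  congr 1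
  rw [Finset.card_eq_sum_card_fiberwise (f := Finset.card) (t := Finset.Icc t n)]
  · apply Finset.sum_congr rfl
    intro k hk
    have : F.filter (fun S => S.card = k) = Finset.powersetCard k Finset.univ := by
      ext S
      have := (Finset.mem_Icc.mp hk).1
      simp only [F, Finset.mem_filter, Finset.mem_univ, true_and, Finset.mem_powersetCard,
        Finset.subset_univ]
      omega
    rw [this, Finset.card_powersetCard, Finset.card_univ, Fintype.card_fin]
  · intro S hS
    have h1 : t ≤ S.card := by simpa [F] using hS
    have h2 : S.card ≤ n := by simpa using Finset.card_le_univ S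
    simp [h1, h2]
end

section
/- Let g : {0,1}^n → {0,1} be a symmetric Boolean function whose lowest-weight 1-input has Hamming weight t, and suppose t > n/2. Then (n − t + 1)·mon(g) ≥ ∑_{i=t}^n C(n,i). -/
/-- If `g` is a symmetric Boolean function whose lowest-weight 1-input has
Hamming weight `t` with `t > n/2`, then `(n - t + 1) · mon(g) ≥ ∑_{i=t}^n C(n,i)`. -/
theorem stmt_8 (n t : ℕ) (g : (Fin n → Bool) → Bool)
    (hsym : ∀ x y : Fin n → Bool,
      (Finset.univ.filter fun i => x i = true).card =
        (Finset.univ.filter fun i => y i = true).card → g x = g y)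
    (ht : n < 2 * t)
    (hmin : ∀ x : Fin n → Bool, g x = true →
      t ≤ (Finset.univ.filter fun i => x i = true).card)
    (hex : ∃ x : Fin n → Bool,
      (Finset.univ.filter fun i => x i = true).card = t ∧ g x = true)
    (a : Finset (Fin n) → ℝ)
    (hrep : ∀ x : Fin n → Bool,
      (if g x then (1 : ℝ) else 0) =
        ∑ S : Finset (Fin n), a S * ∏ i ∈ S, if x i then (1 : ℝ) else 0) :
    ∑ i ∈ Finset.Icc t n, n.choose i ≤
      (n - t + 1) * {S : Finset (Fin n) | a S ≠ 0}.ncard := by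
  have hS : ∀ S : Finset (Fin n),
      (if g (fun i => decide (i ∈ S)) then (1 : ℝ) else 0) = ∑ T ∈ S.powerset, a T := by
    intro S
    rw [hrep, ← Finset.sum_subset (Finset.subset_univ S.powerset)]
    · refine Finset.sum_congr rfl fun T hT => ?_
      rw [Finset.mem_powerset] at hT
      rw [Finset.prod_eq_one, mul_one]
      intro i hi
      simp [hT hi]
    · intro T _ hT
      rw [Finset.mem_powerset, Finset.not_subset] at hT
      obtain ⟨i, hi, hiS⟩ := hT
      rw [Finset.prod_eq_zero hi (by simp [hiS]), mul_zero]
  have hcard : ∀ S : Finset (Fin n),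
      (Finset.univ.filter fun i => (fun i => decide (i ∈ S)) i = true).card = S.card := by
    intro S
    congr 1
    ext i
    simp
  have hzero : ∀ S : Finset (Fin n), S.card < t → a S = 0 := by
    intro S
    induction S using Finset.strongInduction with
    | H S ih =>
      intro hlt
      have h := hS S
      have hg : ¬ (g (fun i => decide (i ∈ S)) = true) := by
        intro hg
        have := hmin _ hg
        rw [hcard] at this
        omega
      rw [if_neg hg, Finset.sum_eq_single S] at h
      · exact h.symm
      · intro T hT hne
        have hss := (Finset.mem_powerset.1 hT).ssubset_of_ne hne
        exact ih T hss ((Finset.card_lt_card hss).trans hlt)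
      · intro h; simp at h
  obtain ⟨x, hx, hgx⟩ := hex
  have hone : ∀ S : Finset (Fin n), S.card = t → a S ≠ 0 := by
    intro S hc
    have h := hS S
    have hg : g (fun i => decide (i ∈ S)) = true := by
      rw [← hgx]
      apply hsym
      rw [hcard, hc, hx]
    rw [if_pos hg, Finset.sum_eq_single S] at h
    · rw [← h]; exact one_ne_zero
    · intro T hT hne
      have hss := (Finset.mem_powerset.1 hT).ssubset_of_ne hne
      exact hzero T (hc ▸ Finset.card_lt_card hss)
    · intro h; simp at h
  have hmon : n.choose t ≤ {S : Finset (Fin n) | a S ≠ 0}.ncard := by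
    have h1 : ((Finset.powersetCard t (Finset.univ : Finset (Fin n)) : Finset _) :
        Set (Finset (Fin n))) ⊆ {S : Finset (Fin n) | a S ≠ 0} := by
      intro S h
      exact hone S (Finset.mem_powersetCard.1 (Finset.mem_coe.1 h)).2
    have h2 := Set.ncard_le_ncard h1 (Set.toFinite _)
    rw [Set.ncard_coe_finset, Finset.card_powersetCard, Finset.card_univ, Fintype.card_fin] at h2
    exact h2
  have htn : t ≤ n := by
    rw [← hx]
    exact (Finset.card_le_univ _).trans (by simp)
  have hch : ∀ i, t ≤ i → n.choose i ≤ n.choose t := by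
    intro i hi
    induction i, hi using Nat.le_induction with
    | base => exact le_rfl
    | succ k hk ih =>
      refine le_trans ?_ ih
      have h := Nat.choose_succ_right_eq n k
      have h2 : n.choose k * (n - k) ≤ n.choose k * (k + 1) :=
        Nat.mul_le_mul_left _ (by omega)
      exact Nat.le_of_mul_le_mul_right (h ▸ h2) (Nat.succ_pos k)
  calc ∑ i ∈ Finset.Icc t n, n.choose i ≤ ∑ i ∈ Finset.Icc t n, n.choose t :=
        Finset.sum_le_sum fun i hi => hch i (Finset.mem_Icc.1 hi).1
    _ = (n - t + 1) * n.choose t := by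
        rw [Finset.sum_const, Nat.card_Icc, smul_eq_mul, Nat.sub_add_comm htn]
    _ ≤ _ := Nat.mul_le_mul_left _ hmon
end

section
/- Let n ≥ 2 and let g : {0,1}^n → {0,1} be a symmetric Boolean function. Then mon(g) ≤ n^{2·s0(g)}, where s0(g) denotes the 0-block sensitivity of g. -/
/-- For an input `x`, `g` has `b` sensitive 0-blocks if there are `b` pairwise
disjoint sets of indices, all of whose variables are `0` in `x`, such that
setting any one block to all-ones flips the value of `g`. -/
def HasZeroBlocks (n : ℕ) (g : (Fin n → Bool) → Bool) (x : Fin n → Bool)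
    (b : ℕ) : Prop :=
  ∃ S : Fin b → Finset (Fin n),
    (∀ i j, i ≠ j → Disjoint (S i) (S j)) ∧
    (∀ i, ∀ k ∈ S i, x k = false) ∧
    (∀ i, g (fun k => if k ∈ S i then true else x k) ≠ g x)

/-- The 0-block sensitivity `s0(g)`: the maximum over inputs `x` of the maximal
number of disjoint sensitive 0-blocks at `x`. -/
noncomputable def zeroBlockSensitivity (n : ℕ) (g : (Fin n → Bool) → Bool) : ℕ :=
  sSup {b : ℕ | ∃ x : Fin n → Bool, HasZeroBlocks n g x b}

theorem hzb_le (n : ℕ) (g : (Fin n → Bool) → Bool) (x : Fin n → Bool) (b : ℕ)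
    (h : HasZeroBlocks n g x b) : b ≤ n := by
  obtain ⟨S, hd, h0, hs⟩ := h
  have hne : ∀ i, ∃ k, k ∈ S i := by
    intro i
    by_contra hc
    push Not at hc
    apply hs i
    congr 1
    funext k
    simp [hc k]
  choose f hf using hne
  have hinj : Function.Injective f := by
    intro i j hij
    by_contra hne
    have := Finset.disjoint_left.mp (hd i j hne) (hf i)
    rw [hij] at this
    exact this (hf j)
  simpa using Fintype.card_le_of_injective f hinj

theorem le_zbs (n : ℕ) (g : (Fin n → Bool) → Bool) (x : Fin n → Bool) (b : ℕ)
    (h : HasZeroBlocks n g x b) : b ≤ zeroBlockSensitivity n g := by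
  apply le_csSup
  · refine ⟨n, ?_⟩
    rintro c ⟨y, hy⟩
    exact hzb_le n g y c hy
  · exact ⟨x, h⟩

theorem card_ind {n : ℕ} (S : Finset (Fin n)) :
    (Finset.univ.filter fun i => (decide (i ∈ S)) = true).card = S.card := by
  congr 1
  ext i
  simp

theorem const_low (n : ℕ) (g : (Fin n → Bool) → Bool)
    (hsym : ∀ x y : Fin n → Bool,
      (Finset.univ.filter fun i => x i = true).card =
        (Finset.univ.filter fun i => y i = true).card → g x = g y)
    (S : Finset (Fin n)) :
    S.card + zeroBlockSensitivity n g ≤ n →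
    g (fun k => decide (k ∈ S)) = g (fun k => decide (k ∈ (∅ : Finset (Fin n)))) := by
  induction S using Finset.induction_on with
  | empty => intro _; rfl
  | insert v S hv ih =>
    intro hc
    rw [Finset.card_insert_of_notMem hv] at hc
    rw [← ih (by omega)]
    by_contra hne
    have hcard : Fintype.card {k // k ∈ Sᶜ} = n - S.card := by
      simp
    have e := (Fintype.equivFinOfCardEq hcard).symm
    have := le_zbs n g (fun k => decide (k ∈ S)) (n - S.card) ⟨fun i => {(e i).1}, by
      refine ⟨?_, ?_, ?_⟩
      · intro i j hij
        rw [Finset.disjoint_singleton]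
        intro h
        exact hij (e.injective (Subtype.ext h))
      · intro i k hk
        have := Finset.mem_compl.mp (e i).2
        rw [Finset.mem_singleton] at hk
        subst hk
        simpa using this
      · intro i h
        apply hne
        rw [← h]
        have hi : (e i).1 ∉ S := Finset.mem_compl.mp (e i).2
        have : (fun k => if k ∈ ({(e i).1} : Finset (Fin n)) then true else decide (k ∈ S))
            = fun k => decide (k ∈ insert (e i).1 S) := by
          funext k
          by_cases hk : k = (e i).1 <;> simp [hk]
        rw [this]
        apply hsym
        rw [card_ind, card_ind, Finset.card_insert_of_notMem hv,
          Finset.card_insert_of_notMem hi]⟩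
    omega

theorem count_big (n s : ℕ) (hn : 2 ≤ n) :
    (Finset.univ.filter fun S : Finset (Fin n) => n < S.card + s).card < n ^ s := by
  calc (Finset.univ.filter fun S : Finset (Fin n) => n < S.card + s).card
      ≤ ((Finset.range s).biUnion
          fun j => Finset.powersetCard j (Finset.univ : Finset (Fin n))).card := by
        apply Finset.card_le_card_of_injOn (fun S => Sᶜ)
        · intro S hS
          have hS : n < S.card + s := by simpa using hS
          have h1 := S.card_le_univ
          rw [Fintype.card_fin] at h1
          simp only [Finset.coe_biUnion, Set.mem_iUnion, Finset.mem_coe,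
            Finset.mem_range, Finset.mem_powersetCard]
          refine ⟨Sᶜ.card, ?_, Finset.subset_univ _, rfl⟩
          rw [Finset.card_compl, Fintype.card_fin]
          omega
        · exact compl_injective.injOn
    _ ≤ ∑ j ∈ Finset.range s, (Finset.powersetCard j (Finset.univ : Finset (Fin n))).card :=
        Finset.card_biUnion_le
    _ ≤ ∑ j ∈ Finset.range s, n ^ j := by
        apply Finset.sum_le_sum
        intro j _
        rw [Finset.card_powersetCard, Finset.card_univ, Fintype.card_fin]
        exact Nat.choose_le_pow n j
    _ < n ^ s := Nat.geomSum_lt hn (by simp)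

/-- For `n ≥ 2` and a symmetric Boolean function `g` on `n` variables,
`mon(g) ≤ n^(2·s0(g))`. -/
theorem stmt_9 (n : ℕ) (hn : 2 ≤ n) (g : (Fin n → Bool) → Bool)
    (hsym : ∀ x y : Fin n → Bool,
      (Finset.univ.filter fun i => x i = true).card =
        (Finset.univ.filter fun i => y i = true).card → g x = g y)
    (a : Finset (Fin n) → ℝ)
    (hrep : ∀ x : Fin n → Bool,
      (if g x then (1 : ℝ) else 0) =
        ∑ S : Finset (Fin n), a S * ∏ i ∈ S, if x i then (1 : ℝ) else 0) :
    {S : Finset (Fin n) | a S ≠ 0}.ncard ≤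
      n ^ (2 * zeroBlockSensitivity n g) := by
  classical
  have key : ∀ S : Finset (Fin n), (if g (fun k => decide (k ∈ S)) then (1 : ℝ) else 0) =
      ∑ T ∈ S.powerset, a T := by
    intro S
    rw [hrep]
    have : ∀ T : Finset (Fin n),
        (a T * ∏ i ∈ T, if decide (i ∈ S) = true then (1 : ℝ) else 0)
          = if T ∈ S.powerset then a T else 0 := by
      intro T
      by_cases hT : T ⊆ S
      · rw [if_pos (Finset.mem_powerset.mpr hT), Finset.prod_eq_one, mul_one]
        intro i hi
        simp [hT hi]
      · rw [if_neg (by simpa using hT)]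
        obtain ⟨i, hi, hiS⟩ := Finset.not_subset.mp hT
        rw [Finset.prod_eq_zero hi (by simp [hiS]), mul_zero]
    simp_rw [this]
    rw [← Finset.sum_filter]
    congr 1
    ext T
    simp
  have hzero : ∀ S : Finset (Fin n), S.Nonempty →
      S.card + zeroBlockSensitivity n g ≤ n → a S = 0 := by
    intro S
    induction S using Finset.strongInduction with
    | H S ih =>
      intro hne hc
      have h1 := key S
      rw [const_low n g hsym S hc, key ∅] at h1
      have h2 : ∑ T ∈ S.powerset, a T = ∑ T ∈ ({∅, S} : Finset (Finset (Fin n))), a T := by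
        symm
        apply Finset.sum_subset
        · intro T hT
          simp only [Finset.mem_insert, Finset.mem_singleton] at hT
          rcases hT with rfl | rfl <;> simp
        · intro T hT hT2
          simp only [Finset.mem_insert, Finset.mem_singleton, not_or] at hT2
          have hss : T ⊂ S := (Finset.mem_powerset.mp hT).ssubset_of_ne hT2.2
          exact ih T hss (Finset.nonempty_iff_ne_empty.mpr hT2.1)
            (by have := Finset.card_lt_card hss; omega)
      rw [h2, Finset.sum_pair hne.ne_empty.symm] at h1
      simpa using h1
  set s := zeroBlockSensitivity n g with hs
  have hsub : {S : Finset (Fin n) | a S ≠ 0} ⊆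
      ((insert ∅ (Finset.univ.filter fun S : Finset (Fin n) => n < S.card + s) :
        Finset (Finset (Fin n))) : Set (Finset (Fin n))) := by
    intro S hS
    simp only [Finset.coe_insert, Set.mem_insert_iff, Finset.mem_coe, Finset.mem_filter,
      Finset.mem_univ, true_and]
    by_contra hc
    push Not at hc
    exact hS (hzero S hc.1 hc.2)
  calc _ ≤ _ := Set.ncard_le_ncard hsub (Finset.finite_toSet _)
    _ = _ := Set.ncard_coe_finset _
    _ ≤ _ := Finset.card_insert_le _ _
    _ ≤ n ^ s := count_big n s hn
    _ ≤ n ^ (2 * s) := Nat.pow_le_pow_right (by omega) (by omega)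
end

section
/- Let g : {0,1}^n → {0,1} be monotone increasing and define f : {0,1}^n × {0,1}^n → {0,1} by f(x,y) = g(x ∧ y). Then the 1-cover number satisfies C^1(f) ≤ mon(g): there exist at most mon(g) rectangles R_i = S_i × T_i with S_i, T_i ⊆ {0,1}^n whose union is exactly the set of pairs (x,y) with f(x,y) = 1. -/
/-- If `g` is monotone increasing and `f(x,y) = g(x ∧ y)`, then `f` has a
1-cover by at most `mon(g)` rectangles: there are rectangles `S_i × T_i`,
`i < k ≤ mon(g)`, whose union is exactly `f⁻¹(1)`. -/
theorem stmt_10 (n : ℕ) (g : (Fin n → Bool) → Bool)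
    (hmono : ∀ x y : Fin n → Bool,
      (∀ i, x i = true → y i = true) → g x = true → g y = true)
    (a : Finset (Fin n) → ℝ)
    (hrep : ∀ x : Fin n → Bool,
      (if g x then (1 : ℝ) else 0) =
        ∑ S : Finset (Fin n), a S * ∏ i ∈ S, if x i then (1 : ℝ) else 0) :
    ∃ (k : ℕ) (S T : Fin k → Set (Fin n → Bool)),
      k ≤ {S : Finset (Fin n) | a S ≠ 0}.ncard ∧
      ∀ x y : Fin n → Bool,
        (g (fun i => x i && y i) = true ↔ ∃ i, x ∈ S i ∧ y ∈ T i) := by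
  classical
  let e : Finset (Fin n) → (Fin n → Bool) := fun S i => decide (i ∈ S)
  have hsum : ∀ U : Finset (Fin n), (∀ T, T ⊂ U → a T = 0) →
      (if g (e U) then (1 : ℝ) else 0) = a U := by
    intro U hU
    rw [hrep (e U), Finset.sum_eq_single U]
    · rw [Finset.prod_eq_one, mul_one]
      intro i hi
      simp [e, hi]
    · intro T _ hT
      by_cases hTU : T ⊆ U
      · rw [hU T (Finset.ssubset_iff_subset_ne.2 ⟨hTU, hT⟩), zero_mul]
      · obtain ⟨i, hi, hiU⟩ := Finset.not_subset.1 hTU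
        rw [Finset.prod_eq_zero hi (by simp [e, hiU]), mul_zero]
    · simp
  have hval : ∀ U : Finset (Fin n), (∀ T, T ⊂ U → ¬ g (e T) = true) →
      a U = if g (e U) then (1 : ℝ) else 0 := by
    intro U
    induction U using Finset.strongInduction with
    | H U ih =>
      intro h
      refine (hsum U ?_).symm
      intro T hT
      rw [ih T hT (fun V hV => h V (hV.trans hT)), if_neg (h T hT)]
  have key : ∀ U : Finset (Fin n), g (e U) = true →
      ∃ S, S ⊆ U ∧ a S ≠ 0 ∧ g (e S) = true := by
    intro U
    induction U using Finset.strongInduction with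
    | H U ih =>
      intro h
      by_cases hT : ∃ T, T ⊂ U ∧ g (e T) = true
      · obtain ⟨T, hTU, hg⟩ := hT
        obtain ⟨S, hS, h2⟩ := ih T hTU hg
        exact ⟨S, hS.trans hTU.1, h2⟩
      · refine ⟨U, subset_rfl, ?_, h⟩
        rw [hval U (fun T h1 h2 => hT ⟨T, h1, h2⟩), if_pos h]
        exact one_ne_zero
  let F : Finset (Finset (Fin n)) := Finset.univ.filter (fun S => a S ≠ 0 ∧ g (e S) = true)
  let R : Fin F.card → Set (Fin n → Bool) :=
    fun j => {x | ∀ i ∈ (F.equivFin.symm j).1, x i = true}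
  refine ⟨F.card, R, R, ?_, ?_⟩
  · rw [← Set.ncard_coe_finset]
    refine Set.ncard_le_ncard ?_ (Set.toFinite _)
    intro S hS
    have hS' : S ∈ F := hS
    exact (Finset.mem_filter.1 hS').2.1
  · intro x y
    constructor
    · intro h
      obtain ⟨S, hS, ha, hg⟩ := key (Finset.univ.filter (fun i => (x i && y i) = true)) (by
        refine hmono _ _ ?_ h
        intro i hi
        simpa [e] using hi)
      have hF : S ∈ F := Finset.mem_filter.2 ⟨Finset.mem_univ _, ha, hg⟩
      have hxy : ∀ i ∈ S, x i = true ∧ y i = true := by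
        intro i hi
        simpa using hS hi
      refine ⟨F.equivFin ⟨S, hF⟩, ?_, ?_⟩
      · intro i hi
        rw [Equiv.symm_apply_apply] at hi
        exact (hxy i hi).1
      · intro i hi
        rw [Equiv.symm_apply_apply] at hi
        exact (hxy i hi).2
    · rintro ⟨j, hx, hy⟩
      have hF := (Finset.mem_filter.1 (F.equivFin.symm j).2).2.2
      refine hmono _ _ ?_ hF
      intro i hi
      have hi' : i ∈ (F.equivFin.symm j).1 := by simpa [e] using hi
      simp [hx i hi', hy i hi']
end

section
/- Let H be a finite family of subsets of {1,…,n} such that every E ∈ H satisfies |E| ≥ s (an s-hypergraph), and suppose |H| < 2^s. Then H has a blocking set of size at most ⌈n/2⌉: there exists S ⊆ {1,…,n} with |S| ≤ ⌈n/2⌉ such that S ∩ E ≠ ∅ for every E ∈ H. -/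
theorem aux_step (m k : ℕ) (h : m + 1 ≤ 2 * k) : 2 * m.choose k ≤ (m + 1).choose k := by
  obtain _ | j := k
  · omega
  · rw [Nat.choose_succ_succ']
    have h1 := Nat.choose_succ_right_eq m j
    have h2 : m.choose (j + 1) * (j + 1) ≤ m.choose j * (j + 1) := by
      rw [h1]
      exact Nat.mul_le_mul_left _ (by omega)
    have h3 := Nat.le_of_mul_le_mul_right h2 (Nat.succ_pos j)
    omega

theorem aux_pow (k e m : ℕ) (h : m + e ≤ 2 * k) : 2 ^ e * m.choose k ≤ (m + e).choose k := by
  induction e with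
  | zero => simp
  | succ e ih =>
    have h1 := ih (by omega)
    have h2 := aux_step (m + e) k (by omega)
    rw [pow_succ, ← add_assoc]
    linarith

/-- If every edge of a finite hypergraph `H` on `{1,…,n}` has size at least `s`
and `|H| < 2^s`, then `H` has a blocking set of size at most `⌈n/2⌉`. -/
theorem stmt_14 (n : ℕ) (s : ℝ) (H : Finset (Finset (Fin n)))
    (hs : ∀ E ∈ H, s ≤ (E.card : ℝ))
    (hH : (H.card : ℝ) < (2 : ℝ) ^ s) :
    ∃ S : Finset (Fin n), S.card ≤ (n + 1) / 2 ∧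
      ∀ E ∈ H, (S ∩ E).Nonempty := by
  classical
  rcases H.eq_empty_or_nonempty with rfl | hne
  · exact ⟨∅, by simp, by simp⟩
  set k := (n + 1) / 2 with hk
  have hN : 0 < n.choose k := Nat.choose_pos (by omega)
  have key : ∀ E ∈ H, H.card * (Finset.powersetCard k Eᶜ).card < n.choose k := by
    intro E hE
    have h1 : H.card < 2 ^ E.card := by
      have : (H.card : ℝ) < (2 : ℝ) ^ (E.card : ℝ) :=
        hH.trans_le (Real.rpow_le_rpow_of_exponent_le (by norm_num) (hs E hE))
      rw [Real.rpow_natCast] at this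
      exact_mod_cast this
    have hc : E.card ≤ n := by simpa using E.card_le_univ
    rw [Finset.card_powersetCard, Finset.card_compl, Fintype.card_fin]
    have h2 := aux_pow k E.card (n - E.card) (by omega)
    rw [Nat.sub_add_cancel hc] at h2
    rcases Nat.eq_zero_or_pos ((n - E.card).choose k) with h0 | h0
    · rw [h0]; simpa using hN
    · exact (Nat.mul_lt_mul_of_pos_right h1 h0).trans_le h2
  have hsum : H.card * ∑ E ∈ H, (Finset.powersetCard k Eᶜ).card < H.card * n.choose k := by
    rw [Finset.mul_sum, ← smul_eq_mul H.card, ← Finset.sum_const]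
    exact Finset.sum_lt_sum_of_nonempty hne key
  have hlt := Nat.lt_of_mul_lt_mul_left hsum
  have hcard : (H.biUnion fun E => Finset.powersetCard k Eᶜ).card
      < (Finset.powersetCard k (Finset.univ : Finset (Fin n))).card := by
    rw [Finset.card_powersetCard, Finset.card_univ, Fintype.card_fin]
    exact Finset.card_biUnion_le.trans_lt hlt
  obtain ⟨S, hS, hS'⟩ := Finset.exists_mem_notMem_of_card_lt_card hcard
  rw [Finset.mem_powersetCard] at hS
  refine ⟨S, hS.2.le, fun E hE => ?_⟩
  by_contra hcon
  apply hS'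
  rw [Finset.mem_biUnion]
  refine ⟨E, hE, Finset.mem_powersetCard.2 ⟨fun x hx => ?_, hS.2⟩⟩
  rw [Finset.mem_compl]
  exact fun hxE => hcon ⟨x, Finset.mem_inter.2 ⟨hx, hxE⟩⟩
end

section
/- Let n be an even positive integer and let NOR : {0,1}^n → {0,1} be defined by NOR(x) = 1 if x = 0^n and NOR(x) = 0 otherwise. Then every multilinear real polynomial p satisfying |NOR(x) − p(x)| ≤ 1/3 for all x ∈ {0,1}^n has at least 2^{√(n/12)} monomials with nonzero coefficient. -/
open Polynomial in
lemma aux_end1 (f : ℝ[X]) (d : ℕ) (hd : f.natDegree ≤ d) (K : ℝ) (hK : 0 < K) (x w : ℝ)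
    (hb : ∀ t ∈ Set.Icc (-1 : ℝ) 1, |f.eval (x + w * (t - 1))| ≤ K) :
    w * (derivative f).eval x ≤ K * d ^ 2 ∧
      w ^ 2 * (derivative (derivative f)).eval x ≤ K * d ^ 4 / 3 := by
  set P : ℝ[X] := C K⁻¹ * f.comp (C w * X + C (x - w)) with hP
  have hdeg : P.degree ≤ d := by
    apply natDegree_le_iff_degree_le.mp
    refine (natDegree_C_mul_le _ _).trans (natDegree_comp_le.trans ?_)
    calc _ ≤ f.natDegree * 1 := Nat.mul_le_mul_left _ natDegree_linear_le
      _ ≤ d := by simpa using hd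
  have hbd : ∀ t ∈ Set.Icc (-1 : ℝ) 1, |P.eval t| ≤ 1 := by
    intro t ht
    have h := hb t ht
    have e : P.eval t = K⁻¹ * f.eval (x + w * (t - 1)) := by
      simp only [hP, eval_mul, eval_C, eval_comp, eval_add, eval_X]
      congr 2; ring
    rw [e, abs_mul, abs_of_pos (inv_pos.2 hK), inv_mul_le_iff₀ hK]
    simpa using h
  have h1 := Chebyshev.eval_iterate_derivative_le_of_forall_abs_le_one (k := 1) (le_refl 1) hdeg hbd
  have h2 := Chebyshev.eval_iterate_derivative_le_of_forall_abs_le_one (k := 2) (le_refl 1) hdeg hbd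
  rw [Chebyshev.iterate_derivative_T_eval_one_eq_div] at h1 h2
  simp only [Function.iterate_succ, Function.iterate_zero, Function.comp, id, hP, derivative_mul, derivative_comp, derivative_C, derivative_add, derivative_X, eval_mul, eval_add, eval_comp, eval_C, eval_X, Finset.prod_range_succ, Finset.prod_range_zero] at h1 h2
  simp at h1 h2
  rw [inv_mul_le_iff₀ hK] at h1 h2
  constructor
  · linarith
  · have : K * ((d : ℝ) ^ 2 * (d ^ 2 - 1) / (2 + 1)) ≤ K * d ^ 4 / 3 := by
      have : 0 ≤ K * (d:ℝ) ^ 2 := by positivity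
      nlinarith
    nlinarith

open Polynomial in
lemma aux_end (f : ℝ[X]) (d : ℕ) (hd : f.natDegree ≤ d) (K : ℝ) (hK : 0 < K) (x w : ℝ)
    (hb : ∀ t ∈ Set.Icc (-1 : ℝ) 1, |f.eval (x + w * (t - 1))| ≤ K) :
    |w| * |(derivative f).eval x| ≤ K * d ^ 2 ∧
      w ^ 2 * |(derivative (derivative f)).eval x| ≤ K * d ^ 4 / 3 := by
  have h1 := aux_end1 f d hd K hK x w hb
  have h2 := aux_end1 (-f) d (by simpa using hd) K hK x w (by simpa using hb)
  simp at h2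
  rw [← abs_mul]
  constructor
  · exact abs_le.2 ⟨by linarith, h1.1⟩
  · rw [← abs_of_nonneg (sq_nonneg w), ← abs_mul]
    exact abs_le.2 ⟨by linarith, h1.2⟩

open Polynomial in
lemma aux_mvt (f : ℝ[X]) (B x y : ℝ) 
    (hB : ∀ z ∈ Set.uIcc x y, |(derivative f).eval z| ≤ B) :
    |f.eval y - f.eval x| ≤ B * |y - x| := by
  have := Convex.norm_image_sub_le_of_norm_deriv_le (f := fun z => f.eval z) (C := B) 
    (s := Set.uIcc x y) (x := x) (y := y) (fun z _ => f.differentiable z)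
    (fun z hz => by simpa using hB z hz) (convex_uIcc x y) Set.left_mem_uIcc Set.right_mem_uIcc
  simpa using this

open Polynomial in
lemma aux_uni (m d : ℕ) (h6 : 6 * d ^ 2 < m) (q : ℝ[X]) (hq : q.natDegree ≤ d)
    (h0 : |1 - q.eval 0| ≤ 1 / 3) (hk : ∀ k : ℕ, 1 ≤ k → k ≤ m → |q.eval (k : ℝ)| ≤ 1 / 3) :
    False := by
  have hmpos : 0 < m := by omega
  have hm1 : (1 : ℝ) ≤ m := by exact_mod_cast hmpos
  have h6' : 6 * (d : ℝ) ^ 2 + 1 ≤ m := by exact_mod_cast h6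
  obtain ⟨f, hf⟩ : ∃ f : ℝ[X], f = q - C (1 / 2) := ⟨_, rfl⟩
  have hfe : ∀ x, f.eval x = q.eval x - 1 / 2 := by intro x; simp [hf]
  have hfd : f.natDegree ≤ d := by
    rw [hf, natDegree_sub_C]; exact hq
  have hint : ∀ k : ℕ, k ≤ m → |f.eval (k : ℝ)| ≤ 5 / 6 := by
    intro k hkm
    rw [hfe, abs_le]
    rcases Nat.eq_zero_or_pos k with rfl | hp
    · have := abs_le.1 h0
      simp only [Nat.cast_zero]
      constructor <;> linarith [this.1, this.2]
    · have := abs_le.1 (hk k hp hkm)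
      constructor <;> linarith [this.1, this.2]
  obtain ⟨y, hy, hmax⟩ := isCompact_Icc.exists_isMaxOn (s := Set.Icc (0 : ℝ) m) ⟨0, by simp⟩
    (f := fun x => |f.eval x|) (by fun_prop)
  obtain ⟨K, hKdef⟩ : ∃ K, K = |f.eval y| := ⟨_, rfl⟩
  have hKb : ∀ x ∈ Set.Icc (0 : ℝ) m, |f.eval x| ≤ K := by
    intro x hx; rw [hKdef]; exact hmax hx
  have hK : 0 < K := by
    have h := hKb 0 ⟨le_refl _, by linarith⟩
    rw [hfe] at h
    have := abs_le.1 h0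
    have := le_abs_self (q.eval 0 - 1 / 2)
    linarith [this]
  -- second derivative bound
  have hB : ∀ x ∈ Set.Icc (0 : ℝ) m, |(derivative (derivative f)).eval x| ≤ 4 / 27 * K := by
    intro x hx
    have key : ∀ w : ℝ, (m : ℝ) / 4 ≤ |w| → (∀ t ∈ Set.Icc (-1 : ℝ) 1, x + w * (t - 1) ∈ Set.Icc (0 : ℝ) m) →
        |(derivative (derivative f)).eval x| ≤ 4 / 27 * K := by
      intro w hw hmem
      have h := (aux_end f d hfd K hK x w (fun t ht => hKb _ (hmem t ht))).2
      have hw2 : (m : ℝ) ^ 2 / 16 ≤ w ^ 2 := by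
        rw [← sq_abs w]; nlinarith
      have hd4 : 36 * (d : ℝ) ^ 4 ≤ m ^ 2 := by nlinarith [sq_nonneg (d : ℝ)]
      have ha := abs_nonneg ((derivative (derivative f)).eval x)
      set A := |(derivative (derivative f)).eval x|
      have h1 : (m : ℝ) ^ 2 / 16 * A ≤ w ^ 2 * A := by gcongr
      have h2 : K * (d : ℝ) ^ 4 / 3 ≤ K * (m ^ 2 / 36) / 3 := by gcongr; linarith
      have h3 : (m : ℝ) ^ 2 * A ≤ m ^ 2 * (4 / 27 * K) := by linarith
      exact le_of_mul_le_mul_left h3 (by positivity)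
    rcases le_total x (m / 2 : ℝ) with hc | hc
    · apply key ((x - m) / 2)
      · rw [abs_of_nonpos (by linarith)]; linarith
      · rintro t ⟨ht1, ht2⟩
        constructor <;> nlinarith [hx.1, hx.2]
    · apply key (x / 2)
      · rw [abs_of_nonneg (by linarith)]; linarith
      · rintro t ⟨ht1, ht2⟩
        constructor <;> nlinarith [hx.1, hx.2]
  -- K < 1
  have hK1 : K < 1 := by
    by_cases hin : y ∈ Set.Ioo (0 : ℝ) m
    · have hder : (derivative f).eval y = 0 := by
        have hn : Set.Icc (0 : ℝ) m ∈ nhds y := Icc_mem_nhds hin.1 hin.2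
        have : IsLocalExtr (fun x => f.eval x) y := by
          rcases le_total 0 (f.eval y) with hs | hs
          · right
            filter_upwards [hn] with z hz
            have := hKb z hz
            rw [hKdef, abs_of_nonneg hs] at this
            exact (le_abs_self _).trans this
          · left
            filter_upwards [hn] with z hz
            have := hKb z hz
            rw [hKdef, abs_of_nonpos hs] at this
            linarith [neg_abs_le (f.eval z)]
        simpa using this.deriv_eq_zero
      obtain ⟨i, him, hi⟩ : ∃ i : ℕ, i ≤ m ∧ |(i : ℝ) - y| ≤ 1 / 2 := by
        have hfl := Nat.floor_le hin.1.le
        have hfl2 := Nat.lt_floor_add_one y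
        have hfm : ⌊y⌋₊ < m := (Nat.floor_lt hin.1.le).2 hin.2
        rcases le_total (y - ⌊y⌋₊) (1 / 2) with h | h
        · exact ⟨⌊y⌋₊, hfm.le, by rw [abs_le]; constructor <;> linarith⟩
        · exact ⟨⌊y⌋₊ + 1, hfm, by push_cast; rw [abs_le]; constructor <;> linarith⟩
      have hsub : Set.uIcc y (i : ℝ) ⊆ Set.Icc (0 : ℝ) m :=
        Set.uIcc_subset_Icc hy ⟨by positivity, by exact_mod_cast him⟩
      have hd1 : ∀ z ∈ Set.uIcc y (i : ℝ), |(derivative f).eval z| ≤ 2 / 27 * K := by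
        intro z hz
        have h := aux_mvt (derivative f) (4 / 27 * K) y z
          (fun u hu => hB u (hsub (Set.uIcc_subset_uIcc_left hz hu)))
        have hzy : |z - y| ≤ 1 / 2 := (Set.abs_sub_left_of_mem_uIcc hz).trans hi
        rw [hder, sub_zero] at h
        nlinarith
      have h := aux_mvt f _ y i hd1
      have h2 := hint i him
      have h3 : K ≤ |f.eval (i : ℝ)| + |f.eval (i : ℝ) - f.eval y| := by
        rw [hKdef]
        have := abs_sub_abs_le_abs_sub (f.eval y) (f.eval (i : ℝ))
        rw [abs_sub_comm] at this
        linarith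
      nlinarith
    · have : ∃ k : ℕ, k ≤ m ∧ y = k := by
        rcases eq_or_lt_of_le hy.1 with h | h
        · exact ⟨0, by simp, by simp [← h]⟩
        · rcases eq_or_lt_of_le hy.2 with h' | h'
          · exact ⟨m, le_refl _, h'⟩
          · exact absurd ⟨h, h'⟩ hin
      obtain ⟨k, hkm, rfl⟩ := this
      have := hint k hkm
      linarith
  -- conclusion
  have hd1 : ∀ z ∈ Set.uIcc (0:ℝ) 1, |(derivative f).eval z| ≤ K / 3 := by
    intro z hz
    rw [Set.uIcc_of_le zero_le_one] at hz
    have h := (aux_end f d hfd K hK z ((z - m) / 2) (fun t ht => hKb _ (by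
      constructor <;> nlinarith [hz.1, hz.2, ht.1, ht.2]))).1
    rw [abs_of_nonpos (by linarith [hz.2])] at h
    set A := |(derivative f).eval z|
    have hA : 0 ≤ A := abs_nonneg _
    rcases Nat.eq_zero_or_pos d with rfl | hdp
    · have : derivative f = 0 := by
        rw [Nat.le_zero] at hfd
        exact derivative_of_natDegree_zero hfd
      have : A = 0 := by simp [A, this]
      rw [this]; positivity
    · have hd' : (1 : ℝ) ≤ d := by exact_mod_cast hdp
      have : (3 * (d : ℝ) ^ 2) * A ≤ 3 * d ^ 2 * (K / 3) := by
        have : (3 * (d : ℝ) ^ 2) * A ≤ -((z - m) / 2) * A := by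
          gcongr; linarith [hz.2]
        linarith
      exact le_of_mul_le_mul_left this (by positivity)
  have h := aux_mvt f (K / 3) 0 1 hd1
  rw [hfe, hfe] at h
  have h1 := abs_le.1 (hk 1 le_rfl hmpos)
  have h2 := abs_le.1 h0
  have h3 := (abs_le.1 h).1
  simp at h1 h3
  linarith [h1.2, h2.2]

open Finset in
lemma aux_cnt {α : Type*} [DecidableEq α] (A S : Finset α) (hS : S ⊆ A) (k : ℕ) :
    #((A.powersetCard k).filter (S ⊆ ·)) * (#A).descFactorial #S =
      (#A).choose k * k.descFactorial #S := by
  rcases le_or_gt #S k with h | h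
  · rw [card_filter_powersetCard_subset S A k hS h, Nat.descFactorial_eq_factorial_mul_choose,
      Nat.descFactorial_eq_factorial_mul_choose]
    have := Nat.choose_mul (n := #A) h
    calc _ = (#S).factorial * ((#A).choose #S * (#A - #S).choose (k - #S)) := by ring
      _ = _ := by rw [← this]; ring
  · rw [Nat.descFactorial_eq_zero_iff_lt.2 h, filter_false_of_mem]
    · simp
    · intro T hT hST
      have := card_le_card hST
      rw [(mem_powersetCard.1 hT).2] at this
      omega

lemma aux_desc (m s : ℕ) : 2 ^ s * m.descFactorial s ≤ (2 * m).descFactorial s := by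
  induction s with
  | zero => simp
  | succ s ih =>
    rw [Nat.descFactorial_succ, Nat.descFactorial_succ]
    calc _ = (2 * (m - s)) * (2 ^ s * m.descFactorial s) := by ring
      _ ≤ _ := Nat.mul_le_mul (by omega) ih

open Finset in
lemma aux_sel {α : Type*} [Fintype α] [DecidableEq α] (m D : ℕ) (hc : Fintype.card α = 2 * m)
    (F : Finset (Finset α)) (hF : #F < 2 ^ D) :
    ∃ A : Finset α, #A = m ∧ ∀ S ∈ F, S ⊆ A → #S < D := by
  by_contra! hcon
  have hone : ∀ S ∈ F.filter (D ≤ #·), 2 ^ D * #((univ.powersetCard m).filter (S ⊆ ·)) ≤ (2 * m).choose m := by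
    intro S hS
    have h := aux_cnt univ S (subset_univ S) m
    rw [card_univ, hc] at h
    have hle : #S ≤ 2 * m := hc ▸ card_le_univ S
    have hp : 0 < (2 * m).descFactorial #S := Nat.descFactorial_pos.2 hle
    have h2 := aux_desc m #S
    have h3 : 2 ^ D ≤ 2 ^ #S := Nat.pow_le_pow_right (by norm_num) (mem_filter.1 hS).2
    refine Nat.le_of_mul_le_mul_right ?_ hp
    calc _ = 2 ^ D * ((2 * m).choose m * m.descFactorial #S) := by rw [← h]; ring
      _ ≤ 2 ^ #S * ((2 * m).choose m * m.descFactorial #S) := Nat.mul_le_mul_right _ h3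
      _ = (2 * m).choose m * (2 ^ #S * m.descFactorial #S) := by ring
      _ ≤ _ := Nat.mul_le_mul_left _ h2
  have hcover : (univ : Finset α).powersetCard m ⊆
      (F.filter (D ≤ #·)).biUnion (fun S => (univ.powersetCard m).filter (S ⊆ ·)) := by
    intro A hA
    obtain ⟨S, hSF, hSA, hD⟩ := hcon A (mem_powersetCard.1 hA).2
    rw [mem_biUnion]
    exact ⟨S, mem_filter.2 ⟨hSF, hD⟩, mem_filter.2 ⟨hA, hSA⟩⟩
  have h1 := (card_le_card hcover).trans card_biUnion_le
  rw [card_powersetCard, card_univ, hc] at h1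
  have hpos : 0 < (2 * m).choose m := Nat.choose_pos (by omega)
  have : 2 ^ D * (2 * m).choose m ≤ #F * (2 * m).choose m := by
    calc _ ≤ 2 ^ D * ∑ S ∈ F.filter (D ≤ #·), #((univ.powersetCard m).filter (S ⊆ ·)) :=
          Nat.mul_le_mul_left _ h1
      _ = ∑ S ∈ F.filter (D ≤ #·), 2 ^ D * #((univ.powersetCard m).filter (S ⊆ ·)) := mul_sum _ _ _
      _ ≤ #(F.filter (D ≤ #·)) • (2 * m).choose m := sum_le_card_nsmul _ _ _ hone
      _ ≤ _ := by rw [smul_eq_mul]; exact Nat.mul_le_mul_right _ (card_filter_le _ _)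
  exact absurd (Nat.le_of_mul_le_mul_right this hpos) (by omega)

open Finset Polynomial in
lemma aux_sym {α : Type*} [Fintype α] [DecidableEq α] (c : Finset α → ℝ) (A : Finset α) (d : ℕ)
    (hd : ∀ S, c S ≠ 0 → S ⊆ A → #S ≤ d) (g : ℕ → ℝ)
    (happ : ∀ T ⊆ A, |g #T - ∑ S, c S * if S ⊆ T then 1 else 0| ≤ 1 / 3) :
    ∃ q : ℝ[X], q.natDegree ≤ d ∧ ∀ k : ℕ, k ≤ #A → |g k - q.eval (k : ℝ)| ≤ 1 / 3 := by
  refine ⟨∑ S ∈ A.powerset, C (c S / (#A).descFactorial #S) * descPochhammer ℝ #S, ?_, ?_⟩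
  · refine natDegree_sum_le_of_forall_le _ _ (fun S hS => ?_)
    by_cases h : c S = 0
    · simp [h]
    · refine (natDegree_C_mul_le _ _).trans ?_
      rw [descPochhammer_natDegree]
      exact hd S h (mem_powerset.1 hS)
  · intro k hk
    have hpos : (0 : ℝ) < (#A).choose k := by exact_mod_cast Nat.choose_pos hk
    have key : ∑ T ∈ A.powersetCard k, ∑ S, c S * (if S ⊆ T then (1 : ℝ) else 0) =
        (#A).choose k * (∑ S ∈ A.powerset, C (c S / (#A).descFactorial #S) * descPochhammer ℝ #S).eval (k : ℝ) := by
      rw [sum_comm, eval_finsetSum, mul_sum]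
      rw [← sum_subset (subset_univ A.powerset)]
      · refine sum_congr rfl (fun S hS => ?_)
        rw [mem_powerset] at hS
        rw [← mul_sum, sum_boole, eval_mul, eval_C, descPochhammer_eval_eq_descFactorial]
        have h := aux_cnt A S hS k
        have hne : ((#A).descFactorial #S : ℝ) ≠ 0 := by
          exact_mod_cast (Nat.descFactorial_pos.2 (card_le_card hS)).ne'
        have h' : (#((A.powersetCard k).filter (S ⊆ ·)) : ℝ) * (#A).descFactorial #S =
          (#A).choose k * k.descFactorial #S := by exact_mod_cast h
        field_simp
        linear_combination c S * h'
      · intro S _ hS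
        refine sum_eq_zero (fun T hT => ?_)
        rw [if_neg, mul_zero]
        intro hST
        exact hS (mem_powerset.2 (hST.trans (mem_powersetCard.1 hT).1))
    have hsum : ∑ T ∈ A.powersetCard k, (g #T - ∑ S, c S * (if S ⊆ T then (1 : ℝ) else 0)) =
        (#A).choose k * (g k - (∑ S ∈ A.powerset, C (c S / (#A).descFactorial #S) * descPochhammer ℝ #S).eval (k : ℝ)) := by
      rw [sum_sub_distrib, key, mul_sub]
      congr 1
      rw [sum_congr rfl (fun T hT => by rw [(mem_powersetCard.1 hT).2]), sum_const,
        card_powersetCard, nsmul_eq_mul]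
    have hle : |∑ T ∈ A.powersetCard k, (g #T - ∑ S, c S * (if S ⊆ T then (1 : ℝ) else 0))| ≤
        (#A).choose k * (1 / 3) := by
      refine (abs_sum_le_sum_abs _ _).trans ?_
      refine (sum_le_card_nsmul _ _ _ (fun T hT => happ T (mem_powersetCard.1 hT).1)).trans ?_
      rw [card_powersetCard, nsmul_eq_mul]
    rw [hsum, abs_mul, abs_of_pos hpos] at hle
    exact le_of_mul_le_mul_left hle hpos

/-- For even positive `n`, every multilinear polynomial approximating the
`NOR` function on `n` variables up to `1/3` has at least `2^√(n/12)` nonzero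
monomials. -/
theorem stmt_15 (n : ℕ) (hn : 0 < n) (hev : Even n)
    (c : Finset (Fin n) → ℝ)
    (happrox : ∀ x : Fin n → Bool,
      |(if ∀ i, x i = false then (1 : ℝ) else 0) -
          ∑ S : Finset (Fin n), c S * ∏ i ∈ S, if x i then (1 : ℝ) else 0| ≤
        1 / 3) :
    (2 : ℝ) ^ Real.sqrt ((n : ℝ) / 12) ≤
      ({S : Finset (Fin n) | c S ≠ 0}.ncard : ℝ) := by
  classical
  by_contra! hlt
  obtain ⟨m, hm⟩ := hev
  have hm0 : 0 < m := by omega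
  have hm0' : (0 : ℝ) < m := by exact_mod_cast hm0
  have hr : (n : ℝ) / 12 = m / 6 := by rw [hm]; push_cast; ring
  rw [hr] at hlt
  obtain ⟨r, hrdef⟩ : ∃ r, r = Real.sqrt ((m : ℝ) / 6) := ⟨_, rfl⟩
  rw [← hrdef] at hlt
  have hrpos : 0 < r := by rw [hrdef]; positivity
  have hrsq : r ^ 2 = m / 6 := by rw [hrdef, Real.sq_sqrt (by positivity)]
  have hset : {S : Finset (Fin n) | c S ≠ 0} = ↑(Finset.univ.filter (fun S => c S ≠ 0)) := by
    ext; simp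
  rw [hset, Set.ncard_coe_finset] at hlt
  have hcard : (Finset.univ.filter (fun S => c S ≠ 0)).card < 2 ^ ⌈r⌉₊ := by
    have : (2 : ℝ) ^ r ≤ 2 ^ (⌈r⌉₊ : ℝ) :=
      Real.rpow_le_rpow_of_exponent_le (by norm_num) (Nat.le_ceil r)
    rw [Real.rpow_natCast] at this
    exact_mod_cast hlt.trans_le this
  obtain ⟨A, hA, hAS⟩ := aux_sel m ⌈r⌉₊ (by simp [hm]; omega) _ hcard
  have hD : 0 < ⌈r⌉₊ := Nat.ceil_pos.2 hrpos
  obtain ⟨q, hq, hqv⟩ := aux_sym c A (⌈r⌉₊ - 1)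
    (fun S hS hSA => by have := hAS S (by simpa using hS) hSA; omega)
    (fun k => if k = 0 then 1 else 0) (by
      intro T _
      have h := happrox (fun i => decide (i ∈ T))
      have e1 : (∀ i, decide (i ∈ T) = false) ↔ T.card = 0 := by
        rw [Finset.card_eq_zero, Finset.eq_empty_iff_forall_notMem]; simp
      have e2 : ∀ S : Finset (Fin n), (∏ i ∈ S, if decide (i ∈ T) then (1 : ℝ) else 0) =
          if S ⊆ T then 1 else 0 := by
        intro S
        simp only [decide_eq_true_eq, Finset.prod_boole]
        rfl
      simp only [e1, e2] at h
      exact h)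
  rw [hA] at hqv
  refine aux_uni m (⌈r⌉₊ - 1) ?_ q hq ?_ ?_
  · have h1 : ((⌈r⌉₊ - 1 : ℕ) : ℝ) < r := by
      have := Nat.ceil_lt_add_one hrpos.le
      rw [Nat.cast_sub hD]; push_cast; linarith
    have h2 : ((⌈r⌉₊ - 1 : ℕ) : ℝ) ^ 2 < r ^ 2 := by gcongr
    have : 6 * ((⌈r⌉₊ - 1 : ℕ) : ℝ) ^ 2 < m := by linarith
    exact_mod_cast this
  · simpa using hqv 0 (Nat.zero_le _)
  · intro k hk1 hkm
    have := hqv k hkm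
    simpa [show k ≠ 0 by omega] using this
end
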